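/- Let θ : ℝ → ℂ have a distributional derivative θ' with ∫_ℝ |θ(x)| e^{β|x|/2} dx < ∞, ∫_ℝ |θ'(x)| e^{β|x|/2} dx < ∞ and ∫_ℝ θ(x) dx = 0. Then for ζ ∈ ℂ there exists a nonzero f ∈ ℰ satisfying 𝔏f + θ*f = ζf in the distributional sense if and only if ζ = −k for some k ∈ ℕ₀; moreover, for each such ζ any two solutions in ℰ are linearly dependent (each eigenspace is one-dimensional). -/

import Mathlib

open MeasureTheory Complex
open scoped ContDiff

/-- Membership in `ℰ = L²(ℝ, cosh(βx) dx)`. -/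
def memE (β : ℝ) (f : ℝ → ℂ) : Prop :=
  AEStronglyMeasurable f volume ∧
    Integrable (fun x : ℝ => ‖f x‖ ^ 2 * Real.cosh (β * x))

/-- `f'` is the distributional derivative of `f`. -/
def IsDistribDeriv (f f' : ℝ → ℂ) : Prop :=
  ∀ φ : ℝ → ℂ, ContDiff ℝ ∞ φ → HasCompactSupport φ →
    ∫ x : ℝ, f x * deriv φ x = -∫ x : ℝ, f' x * φ x

/-- The convolution `(θ * f)(x) = ∫ θ(x−y) f(y) dy`. -/
noncomputable def conv (θ f : ℝ → ℂ) (x : ℝ) : ℂ := ∫ y : ℝ, θ (x - y) * f y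

/-- `𝔏 f + θ*f = ζ f` in the distributional sense. -/
def PerturbedEigenEq (θ : ℝ → ℂ) (ζ : ℂ) (f : ℝ → ℂ) : Prop :=
  ∀ φ : ℝ → ℂ, ContDiff ℝ ∞ φ → HasCompactSupport φ →
    (∫ x : ℝ, f x * (deriv (deriv φ) x - x * deriv φ x))
      + (∫ x : ℝ, conv θ f x * φ x) = ζ * ∫ x : ℝ, f x * φ x

/-- The Fourier transform `ĝ(z) = ∫ g(x) e^{-izx} dx` at complex frequency `z`. -/
noncomputable def fourierC (g : ℝ → ℂ) (z : ℂ) : ℂ := ∫ x : ℝ, g x * Complex.exp (-I * z * x)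

lemma norm_cexp_neg_I_mul (z : ℂ) (x : ℝ) : ‖Complex.exp (-I * z * x)‖ = Real.exp (z.im * x) := by
  rw [Complex.norm_exp]; simp

lemma norm_cexp_neg_I_mul_le {a : ℝ} {z : ℂ} (hz : |z.im| ≤ a) (x : ℝ) :
    ‖Complex.exp (-I * z * x)‖ ≤ Real.exp (a * |x|) := by
  rw [norm_cexp_neg_I_mul, Real.exp_le_exp]
  calc z.im * x ≤ |z.im * x| := le_abs_self _
    _ = |z.im| * |x| := abs_mul _ _
    _ ≤ a * |x| := by gcongr

lemma continuous_cexp_neg_I_mul (z : ℂ) : Continuous fun x : ℝ => Complex.exp (-I * z * x) := by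
  fun_prop

section

variable {g : ℝ → ℂ} {a b : ℝ} {z : ℂ}

lemma integrable_mul_cexp (hg : AEStronglyMeasurable g volume)
    (hint : Integrable fun x : ℝ => ‖g x‖ * Real.exp (a * |x|)) (hz : |z.im| ≤ a) :
    Integrable fun x : ℝ => g x * Complex.exp (-I * z * x) := by
  refine hint.mono' (hg.mul (continuous_cexp_neg_I_mul z).aestronglyMeasurable) ?_
  filter_upwards with x
  rw [norm_mul]
  gcongr
  exact norm_cexp_neg_I_mul_le hz x

lemma norm_fourierC_le (hint : Integrable fun x : ℝ => ‖g x‖ * Real.exp (a * |x|))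
    (hz : |z.im| ≤ a) : ‖fourierC g z‖ ≤ ∫ x : ℝ, ‖g x‖ * Real.exp (a * |x|) := by
  refine norm_integral_le_of_norm_le hint ?_
  filter_upwards with x
  rw [norm_mul]
  gcongr
  exact norm_cexp_neg_I_mul_le hz x

lemma abs_mul_exp_le (hab : b < a) (x : ℝ) :
    |x| * Real.exp (b * |x|) ≤ (a - b)⁻¹ * Real.exp (a * |x|) := by
  have h1 : (a - b) * |x| ≤ Real.exp ((a - b) * |x|) := by
    linarith [Real.add_one_le_exp ((a - b) * |x|)]
  have h2 : Real.exp (a * |x|) = Real.exp ((a - b) * |x|) * Real.exp (b * |x|) := by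
    rw [← Real.exp_add]; ring_nf
  have h3 : 0 < a - b := sub_pos.2 hab
  rw [h2, inv_mul_eq_div, le_div_iff₀ h3]
  nlinarith [Real.exp_pos (b * |x|)]

lemma integrable_mul_self_weight (hg : AEStronglyMeasurable g volume)
    (hint : Integrable fun x : ℝ => ‖g x‖ * Real.exp (a * |x|)) (hab : b < a) :
    Integrable fun x : ℝ => ‖-I * x * g x‖ * Real.exp (b * |x|) := by
  refine (hint.const_mul (a - b)⁻¹).mono' ?_ ?_
  · refine (AEStronglyMeasurable.norm ?_).mul ?_
    · exact (Continuous.aestronglyMeasurable (by fun_prop)).mul hg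
    · exact Continuous.aestronglyMeasurable (by fun_prop)
  · filter_upwards with x
    rw [Real.norm_of_nonneg (by positivity)]
    simp only [norm_mul, norm_neg, norm_I, one_mul, norm_real, Real.norm_eq_abs]
    have := mul_le_mul_of_nonneg_left (abs_mul_exp_le hab x) (norm_nonneg (g x))
    linarith

lemma hasDerivAt_fourierC (hg : AEStronglyMeasurable g volume)
    (hint : Integrable fun x : ℝ => ‖g x‖ * Real.exp (a * |x|)) (hz : |z.im| < a) :
    HasDerivAt (fourierC g) (fourierC (fun x => -I * x * g x) z) z := by
  obtain ⟨b, hb1, hb2⟩ := exists_between hz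
  have hs : {w : ℂ | |w.im| < b} ∈ nhds z :=
    (isOpen_lt (by fun_prop) (by fun_prop)).mem_nhds hb1
  refine (hasDerivAt_integral_of_dominated_loc_of_deriv_le
    (F := fun w (x : ℝ) => g x * Complex.exp (-I * w * x))
    (F' := fun w (x : ℝ) => -I * x * g x * Complex.exp (-I * w * x))
    (bound := fun x : ℝ => ‖-I * x * g x‖ * Real.exp (b * |x|)) hs ?_ ?_ ?_ ?_ ?_ ?_).2
  · filter_upwards with w
    exact hg.mul (continuous_cexp_neg_I_mul w).aestronglyMeasurable
  · exact integrable_mul_cexp hg hint hz.le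
  · exact ((Continuous.aestronglyMeasurable (by fun_prop)).mul hg).mul
      (continuous_cexp_neg_I_mul z).aestronglyMeasurable
  · filter_upwards with x w hw
    rw [norm_mul]
    gcongr
    exact norm_cexp_neg_I_mul_le (le_of_lt hw) x
  · exact integrable_mul_self_weight hg hint hb2
  · filter_upwards with x w hw
    have h : HasDerivAt (fun w : ℂ => -I * w * x) (-I * x) w := by
      simpa using ((hasDerivAt_id w).const_mul (-I)).mul_const (x : ℂ)
    have h' := h.cexp.const_mul (g x)
    rwa [show g x * (Complex.exp (-I * w * x) * (-I * x)) =
      -I * x * g x * Complex.exp (-I * w * x) by ring] at h'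

end

/-- The open strip `|Im z| < a`. -/
def strip (a : ℝ) : Set ℂ := {z | |z.im| < a}

lemma isOpen_strip (a : ℝ) : IsOpen (strip a) := isOpen_lt (by fun_prop) (by fun_prop)

lemma convex_strip (a : ℝ) : Convex ℝ (strip a) := by
  have : strip a = Complex.imLm ⁻¹' (Set.Ioo (-a) a) := by
    ext z; simp [strip, abs_lt]
  rw [this]
  exact (convex_Ioo _ _).linear_preimage _

lemma ofReal_mem_strip {a : ℝ} (ha : 0 < a) (x : ℝ) : (x : ℂ) ∈ strip a := by
  simpa [strip] using ha

lemma zero_mem_strip {a : ℝ} (ha : 0 < a) : (0 : ℂ) ∈ strip a := by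
  simpa [strip] using ha

lemma integrable_exp_neg_mul_abs {c : ℝ} (hc : 0 < c) :
    Integrable fun x : ℝ => Real.exp (-c * |x|) := by
  have h1 : Integrable (fun x : ℝ => (c ^ 2 / 2)⁻¹ * (1 + x ^ 2)⁻¹ + (1 + x ^ 2)⁻¹) :=
    (integrable_inv_one_add_sq.const_mul _).add integrable_inv_one_add_sq
  refine h1.mono' (Continuous.aestronglyMeasurable (by fun_prop)) ?_
  filter_upwards with x
  rw [Real.norm_of_nonneg (Real.exp_pos _).le]
  have h2 := Real.quadratic_le_exp_of_nonneg (x := c * |x|) (by positivity)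
  have h3 : 1 + (c ^ 2 / 2) * x ^ 2 ≤ Real.exp (c * |x|) := by
    have : (c * |x|) ^ 2 = c ^ 2 * x ^ 2 := by rw [mul_pow, sq_abs]
    nlinarith [abs_nonneg x, mul_nonneg hc.le (abs_nonneg x)]
  rw [neg_mul, Real.exp_neg]
  have h4 : 0 < c ^ 2 / 2 := by positivity
  rw [← add_one_mul, inv_le_iff_one_le_mul₀ (Real.exp_pos _), ← div_eq_mul_inv,
    div_mul_eq_mul_div, one_le_div (by positivity)]
  have h5 : 0 < (c ^ 2 / 2)⁻¹ := by positivity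
  calc 1 + x ^ 2 ≤ ((c ^ 2 / 2)⁻¹ + 1) * (1 + c ^ 2 / 2 * x ^ 2) := by
        have : (c ^ 2 / 2)⁻¹ * (c ^ 2 / 2) = 1 := inv_mul_cancel₀ h4.ne'
        have : ((c ^ 2 / 2)⁻¹ + 1) * (1 + c ^ 2 / 2 * x ^ 2)
          = (c ^ 2 / 2)⁻¹ + 1 + ((c ^ 2 / 2)⁻¹ * (c ^ 2 / 2)) * x ^ 2 + c ^ 2 / 2 * x ^ 2 := by ring
        rw [this, ‹(c ^ 2 / 2)⁻¹ * (c ^ 2 / 2) = 1›]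
        nlinarith [sq_nonneg x, mul_nonneg h4.le (sq_nonneg x)]
    _ ≤ _ := by gcongr

lemma memE.integrable_weight {β : ℝ} {f : ℝ → ℂ} (hf : memE β f) {a : ℝ} (ha : a < β / 2) :
    Integrable fun x : ℝ => ‖f x‖ * Real.exp (a * |x|) := by
  have h1 := integrable_exp_neg_mul_abs (c := β - 2 * a) (by linarith)
  refine (hf.2.add h1).mono' (hf.1.norm.mul
    (Continuous.aestronglyMeasurable (by fun_prop))) ?_
  filter_upwards with x
  rw [Real.norm_of_nonneg (by positivity)]
  simp only [Pi.add_apply]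
  set u := ‖f x‖
  have hcosh : Real.exp (β * |x|) ≤ 2 * Real.cosh (β * x) := by
    rw [← Real.cosh_abs, Real.cosh_eq]
    have : β * |x| ≤ |β * x| := by rw [abs_mul]; gcongr; exact le_abs_self β
    have := Real.exp_le_exp.2 this
    linarith [Real.exp_pos (-|β * x|)]
  have e1 : Real.exp (β * |x|) = Real.exp (β / 2 * |x|) ^ 2 := by
    rw [← Real.exp_nat_mul]; push_cast; ring_nf
  have e2 : Real.exp (-(β - 2 * a) * |x|) = Real.exp ((a - β / 2) * |x|) ^ 2 := by
    rw [← Real.exp_nat_mul]; push_cast; ring_nf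
  have e3 : Real.exp (a * |x|) = Real.exp (β / 2 * |x|) * Real.exp ((a - β / 2) * |x|) := by
    rw [← Real.exp_add]; ring_nf
  rw [e2, e3]
  rw [e1] at hcosh
  nlinarith [sq_nonneg (u * Real.exp (β / 2 * |x|) - Real.exp ((a - β / 2) * |x|)),
    mul_le_mul_of_nonneg_left hcosh (sq_nonneg u), sq_nonneg (Real.exp ((a - β / 2) * |x|))]

lemma exists_order_of_euler_eq {F q : ℂ → ℂ} {ζ : ℂ} (hF : AnalyticAt ℂ F 0)
    (hq : ContinuousAt q 0) (hq0 : q 0 = 0)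
    (hode : ∀ᶠ z in nhds (0 : ℂ), z * deriv F z = (q z - ζ) * F z)
    (hne : ¬ ∀ᶠ z in nhds (0 : ℂ), F z = 0) :
    ∃ n : ℕ, ζ = -(n : ℂ) ∧ ∃ v : ℂ → ℂ, AnalyticAt ℂ v 0 ∧ v 0 ≠ 0 ∧
      ∀ᶠ z in nhds (0 : ℂ), F z = z ^ n * v z := by
  obtain ⟨n, v, hv, hv0, hFv⟩ := hF.exists_eventuallyEq_pow_smul_nonzero_iff.2 hne
  simp only [sub_zero, smul_eq_mul] at hFv
  refine ⟨n, ?_, v, hv, hv0, hFv⟩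
  have hderiv : ∀ᶠ z in nhds (0 : ℂ), n * v z * z ^ n + z * deriv v z * z ^ n
      = (q z - ζ) * v z * z ^ n := by
    filter_upwards [hode, hFv.eventually_nhds, hv.eventually_analyticAt] with z h1 h2 h3
    have h4 : deriv F z = n * z ^ (n - 1) * v z + z ^ n * deriv v z := by
      rw [Filter.EventuallyEq.deriv_eq (f := fun z => z ^ n * v z) h2]
      exact ((hasDerivAt_pow n z).mul h3.differentiableAt.hasDerivAt).deriv
    rw [h4, h2.self_of_nhds] at h1
    rcases n with _ | n
    · simp at h1 ⊢; linear_combination h1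
    · simp only [Nat.add_sub_cancel] at h1
      rw [pow_succ] at h1 ⊢
      linear_combination h1
  have hpunct : ∀ᶠ z in nhdsWithin (0 : ℂ) {0}ᶜ, n * v z + z * deriv v z = (q z - ζ) * v z := by
    filter_upwards [nhdsWithin_le_nhds hderiv, self_mem_nhdsWithin] with z h1 h2
    have : z ^ n ≠ 0 := pow_ne_zero _ h2
    exact mul_right_cancel₀ this (by linear_combination h1)
  have hc1 : ContinuousAt (fun z => n * v z + z * deriv v z) 0 :=
    (continuousAt_const.mul hv.continuousAt).add (continuousAt_id.mul hv.deriv.continuousAt)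
  have hc2 : ContinuousAt (fun z => (q z - ζ) * v z) 0 :=
    (hq.sub continuousAt_const).mul hv.continuousAt
  have h := tendsto_nhds_unique_of_eventuallyEq (hc1.tendsto.mono_left nhdsWithin_le_nhds)
    (hc2.tendsto.mono_left nhdsWithin_le_nhds) hpunct
  simp only [zero_mul, add_zero, hq0, zero_sub] at h
  have := mul_right_cancel₀ hv0 h
  rw [this, neg_neg]

lemma exists_linear_relation_of_euler_eq {F₁ F₂ q : ℂ → ℂ} {ζ : ℂ} (hF₁ : AnalyticAt ℂ F₁ 0)
    (hF₂ : AnalyticAt ℂ F₂ 0) (hq : ContinuousAt q 0) (hq0 : q 0 = 0)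
    (hode₁ : ∀ᶠ z in nhds (0 : ℂ), z * deriv F₁ z = (q z - ζ) * F₁ z)
    (hode₂ : ∀ᶠ z in nhds (0 : ℂ), z * deriv F₂ z = (q z - ζ) * F₂ z) :
    ∃ c₁ c₂ : ℂ, (c₁, c₂) ≠ (0, 0) ∧ ∀ᶠ z in nhds (0 : ℂ), c₁ * F₁ z + c₂ * F₂ z = 0 := by
  by_cases h1 : ∀ᶠ z in nhds (0 : ℂ), F₁ z = 0
  · exact ⟨1, 0, by simp, by simpa using h1⟩
  by_cases h2 : ∀ᶠ z in nhds (0 : ℂ), F₂ z = 0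
  · exact ⟨0, 1, by simp, by simpa using h2⟩
  obtain ⟨n, hn, v, hv, hv0, hFv⟩ := exists_order_of_euler_eq hF₁ hq hq0 hode₁ h1
  obtain ⟨m, hm, w, hw, hw0, hFw⟩ := exists_order_of_euler_eq hF₂ hq hq0 hode₂ h2
  have hnm : m = n := by
    have : (m : ℂ) = n := by rw [← neg_inj, ← hm, hn]
    exact_mod_cast this
  subst hnm
  refine ⟨w 0, -v 0, by simp [hw0], ?_⟩
  by_contra hne
  have hode : ∀ᶠ z in nhds (0 : ℂ), z * deriv (fun z => w 0 * F₁ z + -v 0 * F₂ z) z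
      = (q z - ζ) * (w 0 * F₁ z + -v 0 * F₂ z) := by
    filter_upwards [hode₁, hode₂, hF₁.eventually_analyticAt, hF₂.eventually_analyticAt]
      with z e1 e2 a1 a2
    have : deriv (fun z => w 0 * F₁ z + -v 0 * F₂ z) z = w 0 * deriv F₁ z + -v 0 * deriv F₂ z :=
      ((a1.differentiableAt.hasDerivAt.const_mul _).add
        (a2.differentiableAt.hasDerivAt.const_mul _)).deriv
    rw [this]
    linear_combination w 0 * e1 - v 0 * e2
  obtain ⟨k, hk, u, hu, hu0, hFu⟩ := exists_order_of_euler_eq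
    ((analyticAt_const.mul hF₁).add (analyticAt_const.mul hF₂)) hq hq0 hode hne
  have hkm : k = m := by
    have : (k : ℂ) = m := by rw [← neg_inj, ← hk, hn]
    exact_mod_cast this
  subst hkm
  have hpunct : ∀ᶠ z in nhdsWithin (0 : ℂ) {0}ᶜ, u z = w 0 * v z - v 0 * w z := by
    filter_upwards [nhdsWithin_le_nhds hFu, nhdsWithin_le_nhds hFv, nhdsWithin_le_nhds hFw,
      self_mem_nhdsWithin] with z e1 e2 e3 hz
    have : z ^ k ≠ 0 := pow_ne_zero _ hz
    refine mul_left_cancel₀ this ?_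
    simp only [Pi.add_apply, Pi.mul_apply] at e1
    rw [← e1, e2, e3]; ring
  have hc : ContinuousAt (fun z => w 0 * v z - v 0 * w z) 0 :=
    (continuousAt_const.mul hv.continuousAt).sub (continuousAt_const.mul hw.continuousAt)
  have h := tendsto_nhds_unique_of_eventuallyEq
    (hu.continuousAt.tendsto.mono_left nhdsWithin_le_nhds)
    (hc.tendsto.mono_left nhdsWithin_le_nhds) hpunct
  exact hu0 (by rw [h]; ring)

lemma exists_schwartz_fourier_eq {φ : ℝ → ℂ} (hφ : ContDiff ℝ ∞ φ) (hφs : HasCompactSupport φ) :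
    ∃ Ψ : SchwartzMap ℝ ℂ, ∀ x, FourierTransform.fourier (Ψ : ℝ → ℂ) x = φ x := by
  refine ⟨FourierTransformInv.fourierInv (hφs.toSchwartzMap hφ), fun x => ?_⟩
  rw [← SchwartzMap.fourier_coe, FourierTransform.fourier_fourierInv_eq]
  rfl

lemma integral_fourier_smul_schwartz {g : ℝ → ℂ} (hg : Integrable g) (Ψ : SchwartzMap ℝ ℂ) :
    ∫ ξ, FourierTransform.fourier g ξ • Ψ ξ
      = ∫ x, g x • FourierTransform.fourier (Ψ : ℝ → ℂ) x := by
  simpa using! VectorFourier.integral_fourierIntegral_smul_eq_flip (L := innerₗ ℝ)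
    Real.continuous_fourierChar continuous_inner hg Ψ.integrable

lemma ae_eq_zero_of_fourierC_eq_zero {g : ℝ → ℂ} (hg : Integrable g)
    (h : ∀ ξ : ℝ, fourierC g ξ = 0) : g =ᵐ[volume] 0 := by
  have hF : ∀ w : ℝ, FourierTransform.fourier g w = 0 := by
    intro w
    rw [Real.fourier_eq', ← h (2 * Real.pi * w), fourierC]
    congr 1 with x
    rw [smul_eq_mul, mul_comm]
    congr 2
    simp
    ring
  have hae : ∀ᵐ x, g x = 0 := by
    refine ae_eq_zero_of_integral_contDiff_smul_eq_zero hg.locallyIntegrable ?_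
    intro φ hφ hφs
    have hφC : ContDiff ℝ ∞ (fun x => (φ x : ℂ)) := by
      have h1 : ContDiff ℝ ∞ (Complex.ofRealCLM ∘ φ) := by fun_prop
      exact h1
    have hφCs : HasCompactSupport (fun x => (φ x : ℂ)) := 
      hφs.comp_left (g := fun x : ℝ => (x : ℂ)) Complex.ofReal_zero
    obtain ⟨Ψ, hΨ⟩ := exists_schwartz_fourier_eq hφC hφCs
    have key := integral_fourier_smul_schwartz hg Ψ
    simp only [hF, hΨ, zero_smul, integral_zero] at key
    rw [key]
    congr 1 with x
    simp [mul_comm]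
  exact hae

lemma conv_mul_cexp_eq (θ f : ℝ → ℂ) (z : ℂ) :
    (fun x : ℝ => conv θ f x * Complex.exp (-I * z * x)) =
      convolution (fun x : ℝ => f x * Complex.exp (-I * z * x))
        (fun x : ℝ => θ x * Complex.exp (-I * z * x)) (ContinuousLinearMap.mul ℝ ℂ) volume := by
  ext x
  rw [conv, convolution_def, ← integral_mul_const]
  congr 1 with y
  have : Complex.exp (-I * z * x) =
      Complex.exp (-I * z * y) * Complex.exp (-I * z * ((x - y : ℝ) : ℂ)) := by
    rw [← Complex.exp_add]; push_cast; ring_nf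
  rw [this, ContinuousLinearMap.mul_apply']
  ring

lemma integrable_conv_mul_cexp {θ f : ℝ → ℂ} {z : ℂ}
    (hθ : Integrable fun x : ℝ => θ x * Complex.exp (-I * z * x))
    (hf : Integrable fun x : ℝ => f x * Complex.exp (-I * z * x)) :
    Integrable fun x : ℝ => conv θ f x * Complex.exp (-I * z * x) := by
  rw [conv_mul_cexp_eq]
  exact hf.integrable_convolution _ hθ

lemma fourierC_conv {θ f : ℝ → ℂ} {z : ℂ}
    (hθ : Integrable fun x : ℝ => θ x * Complex.exp (-I * z * x))
    (hf : Integrable fun x : ℝ => f x * Complex.exp (-I * z * x)) :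
    fourierC (conv θ f) z = fourierC θ z * fourierC f z := by
  rw [fourierC, conv_mul_cexp_eq, integral_convolution _ hf hθ, ContinuousLinearMap.mul_apply',
    mul_comm]
  rfl

/-- A smooth compactly supported cutoff function, equal to one at the origin. -/
lemma exists_cutoff : ∃ χ : ℝ → ℂ, ContDiff ℝ ∞ χ ∧ HasCompactSupport χ ∧ χ 0 = 1 := by
  let b : ContDiffBump (0 : ℝ) := default
  have h1 : ContDiff ℝ ∞ (Complex.ofRealCLM ∘ b) := by
    have h2 := b.contDiff (n := (⊤ : ℕ∞))
    exact Complex.ofRealCLM.contDiff.comp h2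
  refine ⟨fun x => (b x : ℂ), h1, ?_, ?_⟩
  · exact b.hasCompactSupport.comp_left (g := fun x : ℝ => (x : ℂ)) Complex.ofReal_zero
  · simp [b.one_of_mem_closedBall (Metric.mem_closedBall_self b.rIn_pos.le)]

lemma hasDerivAt_cutoff_mul_cexp {χ χ' : ℝ → ℂ} (h : ∀ x, HasDerivAt χ (χ' x) x) (ε : ℝ) (z : ℂ)
    (x : ℝ) : HasDerivAt (fun x : ℝ => χ (ε * x) * Complex.exp (-I * z * x))
      ((ε * χ' (ε * x) + -I * z * χ (ε * x)) * Complex.exp (-I * z * x)) x := by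
  have h1 : HasDerivAt (fun x : ℝ => ε * x) ε x := by
    simpa using (hasDerivAt_id x).const_mul ε
  have h2 : HasDerivAt (fun x : ℝ => χ (ε * x)) (ε • χ' (ε * x)) x :=
    HasDerivAt.scomp x (h (ε * x)) h1
  have h3 : HasDerivAt (fun x : ℝ => -I * z * (x : ℂ)) (-I * z) x := by
    simpa using (Complex.ofRealCLM.hasDerivAt (x := x)).const_mul (-I * z)
  have h4 := h2.mul h3.cexp
  refine h4.congr_deriv ?_
  rw [real_smul]
  ring

lemma PerturbedEigenEq.euler_eq {θ f : ℝ → ℂ} {ζ z : ℂ} (h : PerturbedEigenEq θ ζ f)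
    (hθ : Integrable fun x : ℝ => θ x * Complex.exp (-I * z * x))
    (hf : Integrable fun x : ℝ => f x * Complex.exp (-I * z * x))
    (hxf : Integrable fun x : ℝ => -I * x * f x * Complex.exp (-I * z * x)) :
    z * fourierC (fun x => -I * x * f x) z = (fourierC θ z - z ^ 2 - ζ) * fourierC f z := by
  obtain ⟨χ, hχ, hχs, hχ0⟩ := exists_cutoff
  set e : ℝ → ℂ := fun x => Complex.exp (-I * z * x) with he
  have hχ1 : ContDiff ℝ ∞ (deriv χ) := (contDiff_infty_iff_deriv.1 hχ).2
  have hχ2 : ContDiff ℝ ∞ (deriv (deriv χ)) := (contDiff_infty_iff_deriv.1 hχ1).2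
  have hd : ∀ x, HasDerivAt χ (deriv χ x) x := fun x =>
    (hχ.differentiable (by simp)).differentiableAt.hasDerivAt
  have hd1 : ∀ x, HasDerivAt (deriv χ) (deriv (deriv χ) x) x := fun x =>
    (hχ1.differentiable (by simp)).differentiableAt.hasDerivAt
  obtain ⟨C₀, hC₀⟩ := hχs.exists_bound_of_continuous hχ.continuous
  obtain ⟨C₁, hC₁⟩ := hχs.deriv.exists_bound_of_continuous hχ1.continuous
  obtain ⟨C₂, hC₂⟩ := hχs.deriv.deriv.exists_bound_of_continuous hχ2.continuous
  let ε : ℕ → ℝ := fun n => 1 / ((n : ℝ) + 1)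
  have hε0 : ∀ n, 0 < ε n := fun n => by positivity
  have hε1 : ∀ n, ε n ≤ 1 := fun n => by
    rw [div_le_one (by positivity)]; linarith [(Nat.cast_nonneg n : (0 : ℝ) ≤ n)]
  have hεl : Filter.Tendsto ε Filter.atTop (nhds 0) := tendsto_one_div_add_atTop_nhds_zero_nat
  let φ : ℕ → ℝ → ℂ := fun n x => χ (ε n * x) * e x
  have hφd : ∀ n, deriv (φ n) = fun x => (ε n * deriv χ (ε n * x) + -I * z * χ (ε n * x)) * e x :=
    fun n => funext fun x => (hasDerivAt_cutoff_mul_cexp hd (ε n) z x).deriv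
  have hφdd : ∀ n x, deriv (deriv (φ n)) x = ((ε n) ^ 2 * deriv (deriv χ) (ε n * x)
      + 2 * ε n * (-I * z) * deriv χ (ε n * x) + (-I * z) ^ 2 * χ (ε n * x)) * e x := by
    intro n x
    have h1 := (hasDerivAt_cutoff_mul_cexp hd1 (ε n) z x).const_mul (ε n : ℂ)
    have h2 := (hasDerivAt_cutoff_mul_cexp hd (ε n) z x).const_mul (-I * z)
    have h3 := (h1.add h2).deriv
    rw [hφd]
    have h4 : (fun x => (ε n * deriv χ (ε n * x) + -I * z * χ (ε n * x)) * e x) =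
      (fun x : ℝ => (ε n : ℂ) * (deriv χ (ε n * x) * Complex.exp (-I * z * x))) +
      (fun x : ℝ => -I * z * (χ (ε n * x) * Complex.exp (-I * z * x))) := by
      ext x; simp only [Pi.add_apply, he]; ring
    rw [h4, h3]
    simp only [he]
    ring
  have hφs : ∀ n, ContDiff ℝ ∞ (φ n) := by
    intro n
    refine (hχ.comp (by fun_prop)).mul ?_
    have : ContDiff ℝ ∞ fun x : ℝ => -I * z * (x : ℂ) :=
      contDiff_const.mul Complex.ofRealCLM.contDiff
    exact this.cexp
  have hφc : ∀ n, HasCompactSupport (φ n) := fun n =>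
    (hχs.comp_homeomorph (Homeomorph.mulLeft₀ (ε n) (hε0 n).ne')).mul_right
  have heq := fun n => h (φ n) (hφs n) (hφc n)
  have hχl : ∀ x, Filter.Tendsto (fun n => χ (ε n * x)) Filter.atTop (nhds 1) := by
    intro x
    have h1 : Filter.Tendsto (fun n => ε n * x) Filter.atTop (nhds 0) := by
      simpa using hεl.mul_const x
    have := (hχ.continuous.tendsto 0).comp h1
    rwa [hχ0] at this
  have hbd : ∀ {u : ℝ → ℂ}, Continuous u → ∀ x, Filter.Tendsto (fun n => (ε n : ℂ) * u (ε n * x))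
      Filter.atTop (nhds 0) := by
    intro u hu x
    have h1 : Filter.Tendsto (fun n => ε n * x) Filter.atTop (nhds 0) := by
      simpa using hεl.mul_const x
    have h2 : Filter.Tendsto (fun n => (ε n : ℂ)) Filter.atTop (nhds 0) := by
      rw [← Complex.ofReal_zero]
      exact (Complex.continuous_ofReal.tendsto 0).comp hεl
    have := h2.mul ((hu.tendsto 0).comp h1)
    simpa using this
  have L1 : Filter.Tendsto (fun n => ∫ x : ℝ, f x * φ n x) Filter.atTop (nhds (fourierC f z)) := by
    refine tendsto_integral_of_dominated_convergence (fun x => C₀ * ‖f x * e x‖) ?_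
      (hf.norm.const_mul _) ?_ ?_
    · intro n
      have h1 : (fun x => f x * φ n x) = fun x => χ (ε n * x) * (f x * e x) := by
        ext x; simp only [φ]; ring
      rw [h1]
      refine (Continuous.aestronglyMeasurable ?_).mul hf.aestronglyMeasurable
      exact hχ.continuous.comp (by fun_prop)
    · intro n
      filter_upwards with x
      have h1 : f x * φ n x = χ (ε n * x) * (f x * e x) := by simp only [φ]; ring
      rw [h1, norm_mul]
      gcongr
      exact hC₀ _
    · filter_upwards with x
      have := (hχl x).mul_const (f x * e x)
      rw [one_mul] at this
      refine this.congr fun n => ?_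
      simp only [φ]; ring
  have hconv := integrable_conv_mul_cexp hθ hf
  have L2 : Filter.Tendsto (fun n => ∫ x : ℝ, conv θ f x * φ n x) Filter.atTop
      (nhds (fourierC θ z * fourierC f z)) := by
    rw [← fourierC_conv hθ hf]
    refine tendsto_integral_of_dominated_convergence (fun x => C₀ * ‖conv θ f x * e x‖) ?_
      (hconv.norm.const_mul _) ?_ ?_
    · intro n
      have h1 : (fun x => conv θ f x * φ n x) = fun x => χ (ε n * x) * (conv θ f x * e x) := by
        ext x; simp only [φ]; ring
      rw [h1]
      refine (Continuous.aestronglyMeasurable ?_).mul hconv.aestronglyMeasurable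
      exact hχ.continuous.comp (by fun_prop)
    · intro n
      filter_upwards with x
      have h1 : conv θ f x * φ n x = χ (ε n * x) * (conv θ f x * e x) := by simp only [φ]; ring
      rw [h1, norm_mul]
      gcongr
      exact hC₀ _
    · filter_upwards with x
      have := (hχl x).mul_const (conv θ f x * e x)
      rw [one_mul] at this
      refine this.congr fun n => ?_
      simp only [φ]; ring
  have L3 : Filter.Tendsto (fun n => ∫ x : ℝ, f x * (deriv (deriv (φ n)) x - x * deriv (φ n) x))
      Filter.atTop (nhds (-z ^ 2 * fourierC f z - z * fourierC (fun x => -I * x * f x) z)) := by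
    have hlim : -z ^ 2 * fourierC f z - z * fourierC (fun x => -I * x * f x) z =
        ∫ x : ℝ, (-z ^ 2 * (f x * e x) - z * (-I * x * f x * e x)) := by
      rw [integral_sub (hf.const_mul _) (hxf.const_mul _), integral_const_mul,
        integral_const_mul]
      rfl
    rw [hlim]
    have hform : ∀ n x, f x * (deriv (deriv (φ n)) x - x * deriv (φ n) x) =
        ((ε n) ^ 2 * deriv (deriv χ) (ε n * x)
        + 2 * ε n * (-I * z) * deriv χ (ε n * x) + (-I * z) ^ 2 * χ (ε n * x)) * (f x * e x)
        + (-I) * (ε n * deriv χ (ε n * x) + -I * z * χ (ε n * x)) * (-I * x * f x * e x) := by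
      intro n x
      rw [hφdd, hφd]
      linear_combination
        (-(x * (ε n * deriv χ (ε n * x) + -I * z * χ (ε n * x)) * f x * e x)) * I_sq
    refine tendsto_integral_of_dominated_convergence
      (fun x => (C₂ + 2 * ‖z‖ * C₁ + ‖z‖ ^ 2 * C₀) * ‖f x * e x‖
        + (C₁ + ‖z‖ * C₀) * ‖-I * x * f x * e x‖) ?_
      ((hf.norm.const_mul _).add (hxf.norm.const_mul _)) ?_ ?_
    · intro n
      simp only [hform]
      have c0 : Continuous fun x => χ (ε n * x) := hχ.continuous.comp (by fun_prop)
      have c1 : Continuous fun x => deriv χ (ε n * x) := hχ1.continuous.comp (by fun_prop)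
      have c2 : Continuous fun x => deriv (deriv χ) (ε n * x) := hχ2.continuous.comp (by fun_prop)
      refine ((Continuous.aestronglyMeasurable ?_).mul hf.aestronglyMeasurable).add
        ((Continuous.aestronglyMeasurable ?_).mul hxf.aestronglyMeasurable)
      · fun_prop
      · fun_prop
    · intro n
      filter_upwards with x
      have n0 := hC₀ (ε n * x)
      have n1 := hC₁ (ε n * x)
      have n2 := hC₂ (ε n * x)
      have hε : ‖(ε n : ℂ)‖ ≤ 1 := by
        rw [norm_real, Real.norm_of_nonneg (hε0 n).le]; exact hε1 n
      have hεm : ∀ {w : ℂ} {C : ℝ}, ‖w‖ ≤ C → ‖(ε n : ℂ)‖ * ‖w‖ ≤ C := fun {w C} hw =>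
        (mul_le_of_le_one_left (norm_nonneg _) hε).trans hw
      rw [hform]
      have b1 : ‖(ε n : ℂ) ^ 2 * deriv (deriv χ) (ε n * x)
        + 2 * ε n * (-I * z) * deriv χ (ε n * x) + (-I * z) ^ 2 * χ (ε n * x)‖ ≤
          C₂ + 2 * ‖z‖ * C₁ + ‖z‖ ^ 2 * C₀ := by
        refine (norm_add₃_le).trans ?_
        refine add_le_add (add_le_add ?_ ?_) ?_
        · rw [pow_two, mul_assoc, norm_mul]
          refine hεm ?_
          rw [norm_mul]
          exact hεm n2
        · have : 2 * (ε n : ℂ) * (-I * z) * deriv χ (ε n * x) =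
            2 * (-I * z) * (ε n * deriv χ (ε n * x)) := by ring
          rw [this, norm_mul, norm_mul]
          simp only [norm_mul, norm_neg, norm_I, one_mul, Complex.norm_ofNat] at hεm ⊢
          gcongr
          exact hεm n1
        · simp only [norm_mul, norm_neg, norm_I, one_mul, norm_pow]
          gcongr
      have b2 : ‖(-I) * (ε n * deriv χ (ε n * x) + -I * z * χ (ε n * x))‖ ≤
          C₁ + ‖z‖ * C₀ := by
        rw [norm_mul, norm_neg, norm_I, one_mul]
        refine (norm_add_le _ _).trans (add_le_add ?_ ?_)
        · rw [norm_mul]; exact hεm n1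
        · simp only [norm_mul, norm_neg, norm_I, one_mul]
          gcongr
      refine (norm_add_le _ _).trans (add_le_add ?_ ?_)
      · rw [norm_mul]; gcongr
      · rw [norm_mul]; gcongr
    · filter_upwards with x
      simp only [hform]
      have l2 := (hbd hχ2.continuous x)
      have l1 := (hbd hχ1.continuous x)
      have l0 := hχl x
      have lε : Filter.Tendsto (fun n => (ε n : ℂ)) Filter.atTop (nhds 0) := by
        simpa using hbd (u := fun _ => 1) continuous_const x
      have t1 := (((lε.mul l2).add (l1.const_mul (2 * (-I * z)))).add
        (l0.const_mul ((-I * z) ^ 2))).mul_const (f x * e x)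
      have t2 := ((l1.add (l0.const_mul (-I * z))).const_mul (-I)).mul_const
        (-I * x * f x * e x)
      have t := t1.add t2
      have hval : (0 * 0 + 2 * (-I * z) * 0 + (-I * z) ^ 2 * 1) * (f x * e x) +
          -I * (0 + -I * z * 1) * (-I * x * f x * e x) =
          -z ^ 2 * (f x * e x) - z * (-I * x * f x * e x) := by
        linear_combination (z ^ 2 * (f x * e x) + z * (-I * x * f x * e x)) * I_sq
      rw [hval] at t
      refine t.congr fun n => ?_
      ring
  have hfin := tendsto_nhds_unique (L3.add L2)
    (((L1.const_mul ζ)).congr fun n => (heq n).symm)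
  linear_combination -hfin

lemma differentiableOn_fourierC_strip {g : ℝ → ℂ} {a : ℝ} (hg : AEStronglyMeasurable g volume)
    (hint : ∀ b < a, Integrable fun x : ℝ => ‖g x‖ * Real.exp (b * |x|)) :
    DifferentiableOn ℂ (fourierC g) (strip a) := by
  intro z hz
  obtain ⟨b, hb1, hb2⟩ := exists_between (show |z.im| < a from hz)
  exact (hasDerivAt_fourierC hg (hint b hb2) hb1).differentiableAt.differentiableWithinAt

lemma fourierC_zero (g : ℝ → ℂ) : fourierC g 0 = ∫ x, g x := by
  simp [fourierC]

lemma integrable_weight_mono {g : ℝ → ℂ} {a b : ℝ} (hg : AEStronglyMeasurable g volume)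
    (hint : Integrable fun x : ℝ => ‖g x‖ * Real.exp (a * |x|)) (hab : b ≤ a) :
    Integrable fun x : ℝ => ‖g x‖ * Real.exp (b * |x|) := by
  refine hint.mono' (hg.norm.mul (Continuous.aestronglyMeasurable (by fun_prop))) ?_
  filter_upwards with x
  rw [Real.norm_of_nonneg (by positivity)]
  gcongr

section

variable {β : ℝ} {θ f : ℝ → ℂ} {ζ : ℂ}

lemma memE.analyticOnNhd (hf : memE β f) : AnalyticOnNhd ℂ (fourierC f) (strip (β / 2)) :=
  (differentiableOn_fourierC_strip hf.1 fun _ hb => hf.integrable_weight hb).analyticOnNhd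
    (isOpen_strip _)

lemma memE.ae_eq_zero (hβ : 0 < β) (hf : memE β f)
    (h : ∀ᶠ z in nhds (0 : ℂ), fourierC f z = 0) : f =ᵐ[volume] 0 := by
  have hb : (0 : ℝ) < β / 2 := by positivity
  have hz := hf.analyticOnNhd.eqOn_zero_of_preconnected_of_eventuallyEq_zero
    (convex_strip _).isPreconnected (zero_mem_strip hb) h
  refine ae_eq_zero_of_fourierC_eq_zero ?_ fun ξ => hz (ofReal_mem_strip hb ξ)
  have := hf.integrable_weight hb
  simp only [zero_mul, Real.exp_zero, mul_one] at this
  exact (integrable_norm_iff hf.1).1 this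

lemma memE.euler_eq (hf : memE β f) (hθmeas : AEStronglyMeasurable θ volume)
    (hθint : Integrable fun x : ℝ => ‖θ x‖ * Real.exp (β / 2 * |x|))
    (h : PerturbedEigenEq θ ζ f) {z : ℂ} (hz : z ∈ strip (β / 2)) :
    z * deriv (fourierC f) z = (fourierC θ z - z ^ 2 - ζ) * fourierC f z := by
  obtain ⟨b, hb1, hb2⟩ := exists_between (show |z.im| < β / 2 from hz)
  obtain ⟨c, hc1, hc2⟩ := exists_between hb2
  have hfc := hf.integrable_weight hc2
  have hxf := integrable_mul_self_weight hf.1 hfc hc1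
  have hm : AEStronglyMeasurable (fun x : ℝ => -I * x * f x) volume :=
    (Continuous.aestronglyMeasurable (by fun_prop)).mul hf.1
  rw [(hasDerivAt_fourierC hf.1 (hf.integrable_weight hb2) hb1).deriv]
  exact h.euler_eq (integrable_mul_cexp hθmeas hθint (le_of_lt hz))
    (integrable_mul_cexp hf.1 hfc (hb1.trans hc1).le) (integrable_mul_cexp hm hxf hb1.le)

lemma memE.eventually_euler_eq (hβ : 0 < β) (hf : memE β f)
    (hθmeas : AEStronglyMeasurable θ volume)
    (hθint : Integrable fun x : ℝ => ‖θ x‖ * Real.exp (β / 2 * |x|))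
    (h : PerturbedEigenEq θ ζ f) :
    ∀ᶠ z in nhds (0 : ℂ), z * deriv (fourierC f) z
      = (fourierC θ z - z ^ 2 - ζ) * fourierC f z := by
  filter_upwards [(isOpen_strip (β / 2)).mem_nhds (zero_mem_strip (by positivity))] with z hz
  exact hf.euler_eq hθmeas hθint h hz

lemma continuousAt_fourierC_sub_sq (hβ : 0 < β) (hθmeas : AEStronglyMeasurable θ volume)
    (hθint : Integrable fun x : ℝ => ‖θ x‖ * Real.exp (β / 2 * |x|)) :
    ContinuousAt (fun z => fourierC θ z - z ^ 2) 0 := by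
  have : |(0 : ℂ).im| < β / 2 := by simpa using hβ
  exact (hasDerivAt_fourierC hθmeas hθint this).continuousAt.sub
    (continuousAt_id.pow 2)

lemma exists_nat_of_solution (hβ : 0 < β) (hθmeas : AEStronglyMeasurable θ volume)
    (hθint : Integrable fun x : ℝ => ‖θ x‖ * Real.exp (β / 2 * |x|))
    (hθmass : ∫ x : ℝ, θ x = 0) (hf : memE β f) (hne : ¬ f =ᵐ[volume] 0)
    (h : PerturbedEigenEq θ ζ f) : ∃ k : ℕ, ζ = -(k : ℂ) := by
  obtain ⟨k, hk, -⟩ := exists_order_of_euler_eq (q := fun z => fourierC θ z - z ^ 2)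
    (hf.analyticOnNhd 0 (zero_mem_strip (by positivity)))
    (continuousAt_fourierC_sub_sq hβ hθmeas hθint) (by simp [fourierC_zero, hθmass])
    (hf.eventually_euler_eq hβ hθmeas hθint h) fun h0 => hne (hf.ae_eq_zero hβ h0)
  exact ⟨k, hk⟩

lemma memE.linear_combination {f₁ f₂ : ℝ → ℂ} (h₁ : memE β f₁) (h₂ : memE β f₂) (c₁ c₂ : ℂ) :
    memE β fun x => c₁ * f₁ x + c₂ * f₂ x := by
  have hm : AEStronglyMeasurable (fun x => c₁ * f₁ x + c₂ * f₂ x) volume :=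
    (h₁.1.const_mul c₁).add (h₂.1.const_mul c₂)
  refine ⟨hm, ((h₁.2.const_mul (2 * ‖c₁‖ ^ 2)).add (h₂.2.const_mul (2 * ‖c₂‖ ^ 2))).mono'
    ((hm.norm.pow 2).mul (Continuous.aestronglyMeasurable (by fun_prop))) ?_⟩
  filter_upwards with x
  have hc := Real.cosh_pos (β * x)
  rw [Real.norm_of_nonneg (by positivity)]
  simp only [Pi.add_apply]
  have h3 : ‖c₁ * f₁ x + c₂ * f₂ x‖ ≤ ‖c₁‖ * ‖f₁ x‖ + ‖c₂‖ * ‖f₂ x‖ := by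
    simpa only [norm_mul] using norm_add_le (c₁ * f₁ x) (c₂ * f₂ x)
  have h4 : ‖c₁ * f₁ x + c₂ * f₂ x‖ ^ 2
      ≤ 2 * ‖c₁‖ ^ 2 * ‖f₁ x‖ ^ 2 + 2 * ‖c₂‖ ^ 2 * ‖f₂ x‖ ^ 2 := by
    refine (pow_le_pow_left₀ (norm_nonneg _) h3 2).trans ?_
    nlinarith [sq_nonneg (‖c₁‖ * ‖f₁ x‖ - ‖c₂‖ * ‖f₂ x‖)]
  nlinarith [mul_le_mul_of_nonneg_right h4 hc.le]

lemma memE.fourierC_linear_combination {f₁ f₂ : ℝ → ℂ} (h₁ : memE β f₁) (h₂ : memE β f₂)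
    (c₁ c₂ : ℂ) {z : ℂ} (hz : z ∈ strip (β / 2)) :
    fourierC (fun x => c₁ * f₁ x + c₂ * f₂ x) z = c₁ * fourierC f₁ z + c₂ * fourierC f₂ z := by
  obtain ⟨b, hb1, hb2⟩ := exists_between (show |z.im| < β / 2 from hz)
  have i₁ := integrable_mul_cexp h₁.1 (h₁.integrable_weight hb2) hb1.le
  have i₂ := integrable_mul_cexp h₂.1 (h₂.integrable_weight hb2) hb1.le
  rw [fourierC, fourierC, fourierC, ← integral_const_mul, ← integral_const_mul,
    ← integral_add (i₁.const_mul _) (i₂.const_mul _)]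
  congr 1 with x
  ring

lemma exists_linear_relation_of_solutions (hβ : 0 < β) (hθmeas : AEStronglyMeasurable θ volume)
    (hθint : Integrable fun x : ℝ => ‖θ x‖ * Real.exp (β / 2 * |x|))
    (hθmass : ∫ x : ℝ, θ x = 0) {f₁ f₂ : ℝ → ℂ} (h₁ : memE β f₁) (h₂ : memE β f₂)
    (e₁ : PerturbedEigenEq θ ζ f₁) (e₂ : PerturbedEigenEq θ ζ f₂) :
    ∃ c₁ c₂ : ℂ, (c₁, c₂) ≠ (0, 0) ∧ (fun x => c₁ * f₁ x + c₂ * f₂ x) =ᵐ[volume] 0 := by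
  have h0 : (0 : ℂ) ∈ strip (β / 2) := zero_mem_strip (by positivity)
  obtain ⟨c₁, c₂, hc, h⟩ := exists_linear_relation_of_euler_eq
    (q := fun z => fourierC θ z - z ^ 2) (h₁.analyticOnNhd 0 h0) (h₂.analyticOnNhd 0 h0)
    (continuousAt_fourierC_sub_sq hβ hθmeas hθint) (by simp [fourierC_zero, hθmass])
    (h₁.eventually_euler_eq hβ hθmeas hθint e₁) (h₂.eventually_euler_eq hβ hθmeas hθint e₂)
  refine ⟨c₁, c₂, hc, (h₁.linear_combination h₂ c₁ c₂).ae_eq_zero hβ ?_⟩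
  filter_upwards [h, (isOpen_strip (β / 2)).mem_nhds h0] with z hz hzs
  rw [h₁.fourierC_linear_combination h₂ c₁ c₂ hzs, hz]

end

lemma exists_slope_of_bounded {q : ℂ → ℂ} {a M : ℝ} (ha : 0 < a)
    (hq : DifferentiableOn ℂ q (strip a)) (hq0 : q 0 = 0) (hM : ∀ z ∈ strip a, ‖q z‖ ≤ M) :
    ∃ (h : ℂ → ℂ) (C : ℝ), DifferentiableOn ℂ h (strip a) ∧ (∀ z, z * h z = q z) ∧
      ∀ z ∈ strip a, ‖h z‖ ≤ C := by
  have hs : strip a ∈ nhds (0 : ℂ) := (isOpen_strip a).mem_nhds (zero_mem_strip ha)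
  have hd : DifferentiableOn ℂ (dslope q 0) (strip a) :=
    (Complex.differentiableOn_dslope hs).2 hq
  have hball : Metric.closedBall (0 : ℂ) (a / 2) ⊆ strip a := by
    intro z hz
    rw [mem_closedBall_zero_iff] at hz
    have := Complex.abs_im_le_norm z
    show |z.im| < a
    linarith
  obtain ⟨C, hC⟩ := (isCompact_closedBall (0 : ℂ) (a / 2)).exists_bound_of_continuousOn
    (hd.continuousOn.mono hball)
  have hmul : ∀ z, z * dslope q 0 z = q z := by
    intro z
    have := sub_smul_dslope q 0 z
    simpa [hq0] using this
  refine ⟨dslope q 0, max C (M / (a / 2)), hd, hmul, fun z hz => ?_⟩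
  by_cases hzb : ‖z‖ ≤ a / 2
  · exact (hC z (by simpa using hzb)).trans (le_max_left _ _)
  · refine le_trans ?_ (le_max_right _ _)
    push Not at hzb
    rw [le_div_iff₀ (by positivity)]
    have h1 := hM z hz
    rw [← hmul z, norm_mul] at h1
    nlinarith [norm_nonneg (dslope q 0 z)]

lemma exists_primitive_on_strip {h : ℂ → ℂ} {a C : ℝ} (ha : 0 < a)
    (hd : DifferentiableOn ℂ h (strip a)) (hC : ∀ z ∈ strip a, ‖h z‖ ≤ C) :
    ∃ H : ℂ → ℂ, (∀ z ∈ strip a, HasDerivAt H (h z) z) ∧ ∀ z ∈ strip a, ‖H z‖ ≤ C * ‖z‖ := by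
  obtain ⟨H, hH⟩ := (convex_strip a).exists_forall_hasDerivWithinAt hd
  refine ⟨fun z => H z - H 0, fun z hz => ?_, fun z hz => ?_⟩
  · exact ((hH z hz).hasDerivAt ((isOpen_strip a).mem_nhds hz)).sub_const _
  · simpa using (convex_strip a).norm_image_sub_le_of_norm_hasDerivWithin_le hH hC
      (zero_mem_strip ha) hz

lemma pow_mul_exp_bound (m : ℕ) {a C : ℝ} {z H : ℂ} (hC : 0 ≤ C) (hz : z ∈ strip a)
    (hH : ‖H‖ ≤ C * ‖z‖) :
    ‖z‖ ^ m * ‖Complex.exp (-z ^ 2 / 2 + H)‖ ≤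
      (m.factorial * Real.exp ((C + 1) * a + a ^ 2 / 2 + (C + 1) ^ 2)) *
        Real.exp (-(1 / 4) * z.re ^ 2) := by
  have ha : |z.im| ≤ a := le_of_lt hz
  have h1 : ‖z‖ ^ m ≤ m.factorial * Real.exp ‖z‖ := by
    have := Real.pow_div_factorial_le_exp ‖z‖ (norm_nonneg z) m
    rwa [div_le_iff₀ (by positivity), mul_comm] at this
  have h2 : ‖Complex.exp (-z ^ 2 / 2 + H)‖ ≤
      Real.exp (-(z.re ^ 2) / 2 + a ^ 2 / 2 + C * ‖z‖) := by
    rw [Complex.norm_exp, Real.exp_le_exp]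
    have e1 : (-z ^ 2 / 2 + H).re = -(z.re ^ 2) / 2 + z.im ^ 2 / 2 + H.re := by
      have : (z ^ 2).re = z.re ^ 2 - z.im ^ 2 := by rw [pow_two, Complex.mul_re]; ring
      have h3 : (-z ^ 2 / 2).re = -(z ^ 2).re / 2 := by
        rw [show (2 : ℂ) = ((2 : ℝ) : ℂ) by simp, Complex.div_ofReal_re, Complex.neg_re]
      rw [Complex.add_re, h3, this]; ring
    rw [e1]
    have e2 : H.re ≤ C * ‖z‖ := (Complex.re_le_norm H).trans hH
    have e3 : z.im ^ 2 ≤ a ^ 2 := by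
      rw [← sq_abs z.im]
      exact pow_le_pow_left₀ (abs_nonneg _) ha 2
    linarith
  have h3 : ‖z‖ ≤ |z.re| + a := (Complex.norm_le_abs_re_add_abs_im z).trans (by linarith)
  calc ‖z‖ ^ m * ‖Complex.exp (-z ^ 2 / 2 + H)‖
      ≤ (m.factorial * Real.exp ‖z‖) * Real.exp (-(z.re ^ 2) / 2 + a ^ 2 / 2 + C * ‖z‖) := by
        gcongr
    _ = m.factorial * Real.exp (-(z.re ^ 2) / 2 + a ^ 2 / 2 + (C + 1) * ‖z‖) := by
        rw [mul_assoc, ← Real.exp_add]; ring_nf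
    _ ≤ m.factorial * Real.exp (((C + 1) * a + a ^ 2 / 2 + (C + 1) ^ 2)
          + -(1 / 4) * z.re ^ 2) := by
        refine mul_le_mul_of_nonneg_left (Real.exp_le_exp.2 ?_) (by positivity)
        have h4 : (C + 1) * ‖z‖ ≤ (C + 1) * (|z.re| + a) := by gcongr
        nlinarith [sq_nonneg (|z.re| / 2 - (C + 1)), sq_abs z.re]
    _ = _ := by rw [Real.exp_add]; ring

lemma exists_solution_on_strip {q : ℂ → ℂ} {a M : ℝ} (ha : 0 < a)
    (hq : DifferentiableOn ℂ q (strip a)) (hq0 : q 0 = 0) (hM : ∀ z ∈ strip a, ‖q z‖ ≤ M)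
    (k : ℕ) :
    ∃ (F : ℂ → ℂ) (A : ℝ), 0 ≤ A ∧ DifferentiableOn ℂ F (strip a) ∧
      (∀ z ∈ strip a, z * deriv F z = (q z - z ^ 2 + k) * F z) ∧
      (∀ z ∈ strip a, ‖F z‖ ≤ A * Real.exp (-(1 / 4) * z.re ^ 2)) ∧
      (∀ z ∈ strip a, ‖deriv F z‖ ≤ A * Real.exp (-(1 / 4) * z.re ^ 2)) ∧ F 1 ≠ 0 := by
  obtain ⟨h, C, hd, hmul, hC⟩ := exists_slope_of_bounded ha hq hq0 hM
  have hC0 : 0 ≤ C := (norm_nonneg _).trans (hC 0 (zero_mem_strip ha))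
  obtain ⟨H, hH, hHC⟩ := exists_primitive_on_strip ha hd hC
  have hderiv : ∀ z ∈ strip a, HasDerivAt (fun z => z ^ k * Complex.exp (-z ^ 2 / 2 + H z))
      ((k * z ^ (k - 1) + z ^ k * (-z + h z)) * Complex.exp (-z ^ 2 / 2 + H z)) z := by
    intro z hz
    have h1 : HasDerivAt (fun z : ℂ => -z ^ 2 / 2 + H z) (-z + h z) z := by
      refine HasDerivAt.add ?_ (hH z hz)
      refine (((hasDerivAt_pow 2 z).neg).div_const 2).congr_deriv ?_
      norm_num
      ring
    refine ((hasDerivAt_pow k z).mul h1.cexp).congr_deriv ?_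
    ring
  set B : ℕ → ℝ := fun m =>
    m.factorial * Real.exp ((C + 1) * a + a ^ 2 / 2 + (C + 1) ^ 2) with hB
  have hB0 : ∀ m, 0 ≤ B m := fun m => by positivity
  refine ⟨fun z => z ^ k * Complex.exp (-z ^ 2 / 2 + H z),
    B k + (k * B (k - 1) + B (k + 1) + C * B k),
    by have := hB0 k; have := hB0 (k - 1); have := hB0 (k + 1); positivity,
    fun z hz => (hderiv z hz).differentiableAt.differentiableWithinAt, ?_, ?_, ?_, ?_⟩
  · intro z hz
    rw [(hderiv z hz).deriv]
    have h1 : z * (k * z ^ (k - 1)) = k * z ^ k := by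
      rcases k with _ | k
      · simp
      · rw [Nat.add_sub_cancel, pow_succ]; ring
    linear_combination Complex.exp (-z ^ 2 / 2 + H z) * h1
      + z ^ k * Complex.exp (-z ^ 2 / 2 + H z) * hmul z
  · intro z hz
    rw [norm_mul, norm_pow]
    refine (pow_mul_exp_bound k hC0 hz (hHC z hz)).trans ?_
    have := hB0 k; have := hB0 (k - 1); have := hB0 (k + 1)
    gcongr
    show B k ≤ _
    have : 0 ≤ k * B (k - 1) + B (k + 1) + C * B k := by positivity
    linarith
  · intro z hz
    rw [(hderiv z hz).deriv, norm_mul]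
    set G := Real.exp (-(1 / 4) * z.re ^ 2)
    set E := ‖Complex.exp (-z ^ 2 / 2 + H z)‖
    have b0 : ‖z‖ ^ (k - 1) * E ≤ B (k - 1) * G := pow_mul_exp_bound (k - 1) hC0 hz (hHC z hz)
    have b1 : ‖z‖ ^ k * E ≤ B k * G := pow_mul_exp_bound k hC0 hz (hHC z hz)
    have b2 : ‖z‖ ^ (k + 1) * E ≤ B (k + 1) * G := pow_mul_exp_bound (k + 1) hC0 hz (hHC z hz)
    have hE : 0 ≤ E := norm_nonneg _
    have hG : 0 ≤ G := (Real.exp_pos _).le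
    have n1 : ‖k * z ^ (k - 1) + z ^ k * (-z + h z)‖ ≤
        k * ‖z‖ ^ (k - 1) + (‖z‖ ^ (k + 1) + C * ‖z‖ ^ k) := by
      refine (norm_add_le _ _).trans (add_le_add ?_ ?_)
      · rw [norm_mul, norm_pow, Complex.norm_natCast]
      · rw [norm_mul, norm_pow]
        have : ‖-z + h z‖ ≤ ‖z‖ + C := by
          refine (norm_add_le _ _).trans (add_le_add (norm_neg z).le (hC z hz))
        calc ‖z‖ ^ k * ‖-z + h z‖ ≤ ‖z‖ ^ k * (‖z‖ + C) := by gcongr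
          _ = _ := by ring
    calc _ ≤ (k * ‖z‖ ^ (k - 1) + (‖z‖ ^ (k + 1) + C * ‖z‖ ^ k)) * E := by gcongr
      _ = k * (‖z‖ ^ (k - 1) * E) + ‖z‖ ^ (k + 1) * E + C * (‖z‖ ^ k * E) := by ring
      _ ≤ k * (B (k - 1) * G) + B (k + 1) * G + C * (B k * G) := by gcongr
      _ ≤ _ := by nlinarith [mul_nonneg (hB0 k) hG]
  · simp [Complex.exp_ne_zero]

section GaussianBound

variable {P : ℂ → ℂ} {a B : ℝ}

lemma hasDerivAt_ofReal_add (b ξ : ℝ) : HasDerivAt (fun ξ : ℝ => (ξ : ℂ) + b * I) 1 ξ := by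
  simpa using (HasDerivAt.ofReal_comp (hasDerivAt_id ξ)).add_const ((b : ℂ) * I)

lemma ofReal_add_mem_strip {b : ℝ} (hb : |b| < a) (ξ : ℝ) : (ξ : ℂ) + b * I ∈ strip a := by
  simpa [strip] using hb

lemma integrable_gaussian_quarter : Integrable fun ξ : ℝ => Real.exp (-(1 / 4) * ξ ^ 2) :=
  integrable_exp_neg_mul_sq (by norm_num)

lemma integrable_of_gaussian_bound {b : ℝ} (hP : ContinuousOn P (strip a))
    (hB : ∀ z ∈ strip a, ‖P z‖ ≤ B * Real.exp (-(1 / 4) * z.re ^ 2)) (hb : |b| < a) :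
    Integrable fun ξ : ℝ => P (ξ + b * I) := by
  refine (integrable_gaussian_quarter.const_mul B).mono' ?_ ?_
  · refine Continuous.aestronglyMeasurable ?_
    exact hP.comp_continuous (by fun_prop) (ofReal_add_mem_strip hb)
  · filter_upwards with ξ
    simpa using hB _ (ofReal_add_mem_strip hb ξ)

lemma integral_deriv_shift_eq_zero {b : ℝ} (hd : DifferentiableOn ℂ P (strip a))
    (hB : ∀ z ∈ strip a, ‖P z‖ ≤ B * Real.exp (-(1 / 4) * z.re ^ 2))
    (hB' : ∀ z ∈ strip a, ‖deriv P z‖ ≤ B * Real.exp (-(1 / 4) * z.re ^ 2)) (hb : |b| < a) :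
    ∫ ξ : ℝ, deriv P (ξ + b * I) = 0 := by
  refine integral_eq_zero_of_hasDerivAt_of_integrable (f := fun ξ : ℝ => P (ξ + b * I))
    (fun ξ => ?_)
    (integrable_of_gaussian_bound (hd.deriv (isOpen_strip a)).continuousOn hB' hb)
    (integrable_of_gaussian_bound hd.continuousOn hB hb)
  have h1 := (hd.differentiableAt
    ((isOpen_strip a).mem_nhds (ofReal_add_mem_strip hb ξ))).hasDerivAt
  exact (h1.comp ξ (hasDerivAt_ofReal_add b ξ)).congr_deriv (mul_one _)

lemma integral_shift_eq {b : ℝ} (hd : DifferentiableOn ℂ P (strip a))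
    (hB : ∀ z ∈ strip a, ‖P z‖ ≤ B * Real.exp (-(1 / 4) * z.re ^ 2))
    (hB' : ∀ z ∈ strip a, ‖deriv P z‖ ≤ B * Real.exp (-(1 / 4) * z.re ^ 2)) (hb : |b| < a) :
    ∫ ξ : ℝ, P (ξ + b * I) = ∫ ξ : ℝ, P ξ := by
  have key : ∀ c ∈ Set.Ioo (-a) a, HasDerivAt (fun c : ℝ => ∫ ξ : ℝ, P (ξ + c * I)) 0 c := by
    intro c hc
    have h := (hasDerivAt_integral_of_dominated_loc_of_deriv_le (𝕜 := ℝ) (μ := volume)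
      (F := fun (c : ℝ) (ξ : ℝ) => P (ξ + c * I))
      (F' := fun (c : ℝ) (ξ : ℝ) => deriv P (ξ + c * I) * I)
      (bound := fun ξ : ℝ => B * Real.exp (-(1 / 4) * ξ ^ 2))
      (isOpen_Ioo.mem_nhds hc) ?_ ?_ ?_ ?_ ?_ ?_).2
    · rwa [integral_mul_const, integral_deriv_shift_eq_zero hd hB hB' (abs_lt.2 hc),
        zero_mul] at h
    · filter_upwards [isOpen_Ioo.mem_nhds hc] with c' hc'
      exact (integrable_of_gaussian_bound hd.continuousOn hB (abs_lt.2 hc')).1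
    · exact integrable_of_gaussian_bound hd.continuousOn hB (abs_lt.2 hc)
    · exact ((integrable_of_gaussian_bound (hd.deriv (isOpen_strip a)).continuousOn hB'
        (abs_lt.2 hc)).mul_const I).1
    · filter_upwards with ξ c' hc'
      simpa using hB' _ (ofReal_add_mem_strip (abs_lt.2 hc') ξ)
    · exact integrable_gaussian_quarter.const_mul B
    · filter_upwards with ξ c' hc'
      have h1 := (hd.differentiableAt
        ((isOpen_strip a).mem_nhds (ofReal_add_mem_strip (abs_lt.2 hc') ξ))).hasDerivAt
      have h2 : HasDerivAt (fun c : ℝ => (ξ : ℂ) + c * I) I c' := by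
        simpa using ((HasDerivAt.ofReal_comp (hasDerivAt_id c')).mul_const I).const_add (ξ : ℂ)
      exact h1.comp c' h2
  have h0 : (0 : ℝ) ∈ Set.Ioo (-a) a := by
    have := (abs_nonneg b).trans_lt hb
    exact ⟨by linarith, this⟩
  have := isOpen_Ioo.is_const_of_deriv_eq_zero (𝕜 := ℝ) isPreconnected_Ioo
    (fun c hc => (key c hc).differentiableAt.differentiableWithinAt)
    (fun c hc => (key c hc).deriv) (abs_lt.1 hb) h0
  simpa using this

end GaussianBound

section Decay

variable {F : ℂ → ℂ} {a A : ℝ}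

lemma hasDerivAt_cexp_neg_I_mul (w z : ℂ) :
    HasDerivAt (fun z : ℂ => Complex.exp (-I * w * z)) (-I * w * Complex.exp (-I * w * z)) z := by
  have := ((hasDerivAt_id z).const_mul (-I * w)).cexp
  simpa [mul_comm] using this

lemma norm_cexp_neg_I_mul_shift (x b ξ : ℝ) :
    ‖Complex.exp (-I * (-x) * (ξ + b * I))‖ = Real.exp (-(b * x)) := by
  rw [Complex.norm_exp]
  congr 1
  simp
  ring

lemma norm_fourierC_strip_le {b : ℝ} (hd : DifferentiableOn ℂ F (strip a)) (hA : 0 ≤ A)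
    (hF : ∀ z ∈ strip a, ‖F z‖ ≤ A * Real.exp (-(1 / 4) * z.re ^ 2))
    (hF' : ∀ z ∈ strip a, ‖deriv F z‖ ≤ A * Real.exp (-(1 / 4) * z.re ^ 2)) (hb : |b| < a)
    (x : ℝ) :
    (1 + |x|) * ‖fourierC (fun ξ : ℝ => F ξ) (-x)‖ ≤
      2 * (A * ∫ ξ : ℝ, Real.exp (-(1 / 4) * ξ ^ 2)) * Real.exp (-(b * x)) := by
  set e : ℂ → ℂ := fun z => Complex.exp (-I * (-x) * z) with he
  have he' : ∀ z, HasDerivAt e (-I * (-x) * e z) z := hasDerivAt_cexp_neg_I_mul _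
  have hder : ∀ z ∈ strip a,
      HasDerivAt (fun z => F z * e z) (deriv F z * e z + I * x * (F z * e z)) z := by
    intro z hz
    have h1 := (hd.differentiableAt ((isOpen_strip a).mem_nhds hz)).hasDerivAt
    refine (h1.mul (he' z)).congr_deriv ?_
    ring
  have hene : ∀ z ∈ strip a, ‖e z‖ ≤ Real.exp (a * |x|) := by
    intro z hz
    rw [he, Complex.norm_exp, Real.exp_le_exp]
    have : (-I * (-x) * z).re = -(z.im * x) := by simp; ring
    rw [this]
    calc -(z.im * x) ≤ |z.im * x| := neg_le_abs _
      _ = |z.im| * |x| := abs_mul _ _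
      _ ≤ a * |x| := by gcongr; exact le_of_lt hz
  have hPd : DifferentiableOn ℂ (fun z => F z * e z) (strip a) :=
    fun z hz => (hder z hz).differentiableAt.differentiableWithinAt
  set B := (1 + |x|) * (A * Real.exp (a * |x|)) with hBdef
  have hFe : ∀ z ∈ strip a, ‖F z * e z‖ ≤
      A * Real.exp (a * |x|) * Real.exp (-(1 / 4) * z.re ^ 2) := by
    intro z hz
    rw [norm_mul]
    calc _ ≤ (A * Real.exp (-(1 / 4) * z.re ^ 2)) * Real.exp (a * |x|) :=
          mul_le_mul (hF z hz) (hene z hz) (norm_nonneg _) (by positivity)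
      _ = _ := by ring
  have hF'e : ∀ z ∈ strip a, ‖deriv F z * e z‖ ≤
      A * Real.exp (a * |x|) * Real.exp (-(1 / 4) * z.re ^ 2) := by
    intro z hz
    rw [norm_mul]
    calc _ ≤ (A * Real.exp (-(1 / 4) * z.re ^ 2)) * Real.exp (a * |x|) :=
          mul_le_mul (hF' z hz) (hene z hz) (norm_nonneg _) (by positivity)
      _ = _ := by ring
  have hBP : ∀ z ∈ strip a, ‖F z * e z‖ ≤ B * Real.exp (-(1 / 4) * z.re ^ 2) := by
    intro z hz
    refine (hFe z hz).trans ?_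
    gcongr
    rw [hBdef]
    exact le_mul_of_one_le_left (by positivity) (by linarith [abs_nonneg x])
  have hBP' : ∀ z ∈ strip a, ‖deriv (fun z => F z * e z) z‖ ≤
      B * Real.exp (-(1 / 4) * z.re ^ 2) := by
    intro z hz
    rw [(hder z hz).deriv]
    refine (norm_add_le _ _).trans ?_
    rw [norm_mul (I * (x : ℂ))]
    have h1 : ‖I * (x : ℂ)‖ = |x| := by simp
    rw [h1, hBdef]
    have := mul_le_mul_of_nonneg_left (hFe z hz) (abs_nonneg x)
    linarith [hF'e z hz]
  have hshift := integral_shift_eq hPd hBP hBP' hb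
  have hzero := integral_deriv_shift_eq_zero hPd hBP hBP' hb
  have hfour : fourierC (fun ξ : ℝ => F ξ) (-x) = ∫ ξ : ℝ, F (ξ + b * I) * e (ξ + b * I) := by
    rw [hshift]; rfl
  set J := ∫ ξ : ℝ, Real.exp (-(1 / 4) * ξ ^ 2) with hJ
  have bound : ∀ G : ℂ → ℂ, (∀ z ∈ strip a, ‖G z‖ ≤ A * Real.exp (-(1 / 4) * z.re ^ 2)) →
      ‖∫ ξ : ℝ, G (ξ + b * I) * e (ξ + b * I)‖ ≤ A * J * Real.exp (-(b * x)) := by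
    intro G hG
    have : A * J * Real.exp (-(b * x)) =
        ∫ ξ : ℝ, A * Real.exp (-(b * x)) * Real.exp (-(1 / 4) * ξ ^ 2) := by
      rw [integral_const_mul]; ring
    rw [this]
    refine norm_integral_le_of_norm_le (integrable_gaussian_quarter.const_mul _) ?_
    filter_upwards with ξ
    rw [norm_mul, norm_cexp_neg_I_mul_shift]
    have h1 := hG _ (ofReal_add_mem_strip hb ξ)
    simp only [add_re, ofReal_re, mul_re, I_re, mul_zero, ofReal_im, I_im, zero_mul, sub_self,
      add_zero] at h1
    have := mul_le_mul_of_nonneg_right h1 (Real.exp_pos (-(b * x))).le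
    linarith
  have b1 := bound F hF
  have b2 := bound (deriv F) hF'
  have hxf : (I * x) * ∫ ξ : ℝ, F (ξ + b * I) * e (ξ + b * I) =
      -∫ ξ : ℝ, deriv F (ξ + b * I) * e (ξ + b * I) := by
    have i1 : Integrable fun ξ : ℝ => F (ξ + b * I) * e (ξ + b * I) :=
      integrable_of_gaussian_bound (P := fun z => F z * e z) hPd.continuousOn hFe hb
    have i2 : Integrable fun ξ : ℝ => deriv F (ξ + b * I) * e (ξ + b * I) :=
      integrable_of_gaussian_bound (P := fun z => deriv F z * e z)
        ((hd.deriv (isOpen_strip a)).continuousOn.mul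
          (fun z _ => (he' z).continuousAt.continuousWithinAt)) hF'e hb
    have : ∫ ξ : ℝ, deriv (fun z => F z * e z) (ξ + b * I) =
        ∫ ξ : ℝ, (deriv F (ξ + b * I) * e (ξ + b * I)
          + I * x * (F (ξ + b * I) * e (ξ + b * I))) := by
      congr 1; ext ξ
      exact (hder _ (ofReal_add_mem_strip hb ξ)).deriv
    rw [this, integral_add i2 (i1.const_mul _), integral_const_mul] at hzero
    linear_combination hzero
  have hn := congrArg norm hxf
  rw [norm_mul, norm_neg, show ‖I * (x : ℂ)‖ = |x| by simp] at hn
  rw [hfour, add_mul, one_mul, hn]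
  linarith

lemma norm_fourierC_decay (ha : 0 < a) (hd : DifferentiableOn ℂ F (strip a)) (hA : 0 ≤ A)
    (hF : ∀ z ∈ strip a, ‖F z‖ ≤ A * Real.exp (-(1 / 4) * z.re ^ 2))
    (hF' : ∀ z ∈ strip a, ‖deriv F z‖ ≤ A * Real.exp (-(1 / 4) * z.re ^ 2)) (x : ℝ) :
    (1 + |x|) * ‖fourierC (fun ξ : ℝ => F ξ) (-x)‖ ≤
      2 * (A * ∫ ξ : ℝ, Real.exp (-(1 / 4) * ξ ^ 2)) * Real.exp (-(a * |x|)) := by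
  have hlim : Filter.Tendsto (fun c : ℝ =>
      2 * (A * ∫ ξ : ℝ, Real.exp (-(1 / 4) * ξ ^ 2)) * Real.exp (-(c * |x|)))
      (nhdsWithin a (Set.Iio a)) (nhds (2 * (A * ∫ ξ : ℝ, Real.exp (-(1 / 4) * ξ ^ 2)) *
        Real.exp (-(a * |x|)))) := by
    refine (Continuous.tendsto ?_ a).mono_left nhdsWithin_le_nhds
    fun_prop
  refine ge_of_tendsto hlim ?_
  filter_upwards [Ioo_mem_nhdsLT ha] with c hc
  rcases le_total 0 x with hx | hx
  · rw [abs_of_nonneg hx]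
    have := norm_fourierC_strip_le hd hA hF hF' (b := c) (by rw [abs_of_pos hc.1]; exact hc.2) x
    rwa [abs_of_nonneg hx] at this
  · rw [abs_of_nonpos hx]
    have := norm_fourierC_strip_le hd hA hF hF' (b := -c)
      (by rw [abs_neg, abs_of_pos hc.1]; exact hc.2) x
    rwa [abs_of_nonpos hx, show -(-c * x) = -(c * -x) by ring] at this

end Decay

lemma memE_of_decay {β C : ℝ} {f : ℝ → ℂ} (hβ : 0 < β) (hf : Continuous f)
    (h : ∀ x, (1 + |x|) * ‖f x‖ ≤ C * Real.exp (-(β / 2 * |x|))) : memE β f := by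
  refine ⟨hf.aestronglyMeasurable, ?_⟩
  refine (integrable_inv_one_add_sq.const_mul (C ^ 2)).mono'
    (Continuous.aestronglyMeasurable (by fun_prop)) ?_
  filter_upwards with x
  rw [Real.norm_of_nonneg (by positivity), ← div_eq_mul_inv, le_div_iff₀ (by positivity)]
  have hcosh : Real.cosh (β * x) ≤ Real.exp (β / 2 * |x|) ^ 2 := by
    rw [← Real.cosh_abs, abs_mul, abs_of_pos hβ, Real.cosh_eq, ← Real.exp_nat_mul]
    have h1 : Real.exp (-(β * |x|)) ≤ Real.exp (β * |x|) := by
      rw [Real.exp_le_exp]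
      have : 0 ≤ β * |x| := by positivity
      linarith
    have h2 : ((2 : ℕ) : ℝ) * (β / 2 * |x|) = β * |x| := by push_cast; ring
    rw [h2]
    linarith
  have h1 : ((1 + |x|) * ‖f x‖) * Real.exp (β / 2 * |x|) ≤ C := by
    calc _ ≤ (C * Real.exp (-(β / 2 * |x|))) * Real.exp (β / 2 * |x|) := 
          mul_le_mul_of_nonneg_right (h x) (Real.exp_pos _).le
      _ = C := by rw [mul_assoc, ← Real.exp_add]; simp
  have h2 : (((1 + |x|) * ‖f x‖) * Real.exp (β / 2 * |x|)) ^ 2 ≤ C ^ 2 :=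
    pow_le_pow_left₀ (by positivity) h1 2
  refine le_trans ?_ h2
  calc ‖f x‖ ^ 2 * Real.cosh (β * x) * (1 + x ^ 2)
      ≤ ‖f x‖ ^ 2 * Real.exp (β / 2 * |x|) ^ 2 * (1 + |x|) ^ 2 := by
        gcongr
        nlinarith [sq_abs x, abs_nonneg x]
    _ = _ := by ring

/-- The inverse Fourier transform `x ↦ (2π)⁻¹ ∫ G(ξ) e^{iξx} dξ`. -/
noncomputable def invF (G : ℝ → ℂ) (x : ℝ) : ℂ := (2 * Real.pi)⁻¹ * fourierC G (-x)

section Inversion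

variable {G G' : ℝ → ℂ}

lemma integrable_mul_cexp_neg (hG : AEStronglyMeasurable G volume)
    (hw : ∀ c : ℝ, Integrable fun ξ : ℝ => ‖G ξ‖ * Real.exp (c * |ξ|)) (x : ℝ) :
    Integrable fun ξ : ℝ => G ξ * Complex.exp (-I * (-x) * ξ) :=
  integrable_mul_cexp hG (hw 0) (by simp)

lemma integrable_I_mul_weight (hG : AEStronglyMeasurable G volume)
    (hw : ∀ c : ℝ, Integrable fun ξ : ℝ => ‖G ξ‖ * Real.exp (c * |ξ|)) (c : ℝ) :
    Integrable fun ξ : ℝ => ‖I * ξ * G ξ‖ * Real.exp (c * |ξ|) := by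
  refine (integrable_mul_self_weight hG (hw (c + 1)) (lt_add_one c)).congr ?_
  filter_upwards with ξ
  simp

lemma hasDerivAt_invF (hG : AEStronglyMeasurable G volume)
    (hw : ∀ c : ℝ, Integrable fun ξ : ℝ => ‖G ξ‖ * Real.exp (c * |ξ|)) (x : ℝ) :
    HasDerivAt (invF G) (invF (fun ξ => I * ξ * G ξ) x) x := by
  have h1 := hasDerivAt_fourierC (z := -(x : ℂ)) hG (hw 1) (by simp)
  have h2 : HasDerivAt (fun x : ℝ => -(x : ℂ)) (-1) x :=
    (HasDerivAt.ofReal_comp (hasDerivAt_id x)).neg.congr_deriv (by simp)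
  have h3 := (h1.comp x h2).const_mul (((2 * Real.pi)⁻¹ : ℝ) : ℂ)
  refine HasDerivAt.congr_deriv (f := invF G) h3 ?_
  rw [invF, fourierC, fourierC, mul_neg_one, ← integral_neg]
  congr 2 with ξ
  ring

lemma continuous_invF (hG : AEStronglyMeasurable G volume)
    (hw : ∀ c : ℝ, Integrable fun ξ : ℝ => ‖G ξ‖ * Real.exp (c * |ξ|)) : Continuous (invF G) :=
  continuous_iff_continuousAt.2 fun x => (hasDerivAt_invF hG hw x).continuousAt

lemma mul_invF_eq (hG : AEStronglyMeasurable G volume) (hG' : AEStronglyMeasurable G' volume)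
    (hw : ∀ c : ℝ, Integrable fun ξ : ℝ => ‖G ξ‖ * Real.exp (c * |ξ|))
    (hw' : ∀ c : ℝ, Integrable fun ξ : ℝ => ‖G' ξ‖ * Real.exp (c * |ξ|))
    (hd : ∀ ξ, HasDerivAt G (G' ξ) ξ) (x : ℝ) : x * invF G x = I * invF G' x := by
  have i1 := integrable_mul_cexp_neg hG hw x
  have i2 := integrable_mul_cexp_neg hG' hw' x
  have h0 : ∫ ξ : ℝ, (G' ξ * Complex.exp (-I * (-x) * ξ)
      + I * x * (G ξ * Complex.exp (-I * (-x) * ξ))) = 0 := by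
    refine integral_eq_zero_of_hasDerivAt_of_integrable
      (f := fun ξ : ℝ => G ξ * Complex.exp (-I * (-x) * ξ)) (fun ξ => ?_)
      (i2.add (i1.const_mul _)) i1
    refine ((hd ξ).mul (hasDerivAt_cexp_neg_I_mul (-x) ξ).comp_ofReal).congr_deriv ?_
    ring
  rw [integral_add i2 (i1.const_mul _), integral_const_mul] at h0
  rw [invF, invF, fourierC, fourierC]
  linear_combination (-I * ((2 * Real.pi)⁻¹ : ℝ)) * h0
    + (x * ((2 * Real.pi)⁻¹ : ℝ) * ∫ ξ : ℝ, G ξ * Complex.exp (-I * (-x) * ξ)) * I_sq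

lemma conv_invF {θ : ℝ → ℂ} (hθ : Integrable θ) (hG : Integrable G) (x : ℝ) :
    conv θ (invF G) x = invF (fun ξ => fourierC θ ξ * G ξ) x := by
  have hprod : Integrable (Function.uncurry fun y ξ : ℝ =>
      θ y * Complex.exp (-I * ξ * y) * (G ξ * Complex.exp (-I * (-x) * ξ)))
      (volume.prod volume) := by
    refine (hθ.norm.mul_prod hG.norm).mono' ?_ ?_
    · exact ((hθ.1.comp_fst).mul (Continuous.aestronglyMeasurable (by fun_prop))).mul
        ((hG.1.comp_snd).mul (Continuous.aestronglyMeasurable (by fun_prop)))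
    · filter_upwards with p
      simp only [Function.uncurry, norm_mul]
      have e1 : ‖Complex.exp (-I * p.2 * p.1)‖ = 1 := by
        rw [norm_cexp_neg_I_mul]; simp
      have e2 : ‖Complex.exp (-I * (-x) * p.2)‖ = 1 := by
        rw [norm_cexp_neg_I_mul]; simp
      rw [e1, e2, mul_one, mul_one]
  have hswap := integral_integral_swap hprod
  have e1 : conv θ (invF G) x = (2 * Real.pi)⁻¹ * ∫ y : ℝ, ∫ ξ : ℝ,
      θ y * Complex.exp (-I * ξ * y) * (G ξ * Complex.exp (-I * (-x) * ξ)) := by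
    rw [conv, ← integral_sub_left_eq_self _ volume x, ← integral_const_mul]
    congr 1 with y
    rw [sub_sub_cancel, invF, fourierC, ← integral_const_mul, ← integral_const_mul,
      ← integral_const_mul]
    congr 1 with ξ
    have : Complex.exp (-I * (-((x - y : ℝ) : ℂ)) * ξ) =
        Complex.exp (-I * ξ * y) * Complex.exp (-I * (-x) * ξ) := by
      rw [← Complex.exp_add]; congr 1; push_cast; ring
    rw [this]
    ring
  rw [e1, hswap, invF, fourierC]
  congr 2 with ξ
  rw [integral_mul_const, fourierC]
  ring

end Inversion

lemma integrable_gaussian_weight {G : ℝ → ℂ} {A : ℝ} (hG : AEStronglyMeasurable G volume)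
    (h : ∀ ξ, ‖G ξ‖ ≤ A * Real.exp (-(1 / 4) * ξ ^ 2)) (c : ℝ) :
    Integrable fun ξ : ℝ => ‖G ξ‖ * Real.exp (c * |ξ|) := by
  have hA : 0 ≤ A := by
    have := (norm_nonneg _).trans (h 0)
    simpa using this
  refine ((integrable_exp_neg_mul_sq (b := 1 / 8) (by norm_num)).const_mul
    (A * Real.exp (2 * c ^ 2))).mono' (hG.norm.mul
      (Continuous.aestronglyMeasurable (by fun_prop))) ?_
  filter_upwards with ξ
  rw [Real.norm_of_nonneg (by positivity)]
  calc ‖G ξ‖ * Real.exp (c * |ξ|)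
      ≤ (A * Real.exp (-(1 / 4) * ξ ^ 2)) * Real.exp (c * |ξ|) := by gcongr; exact h ξ
    _ = A * Real.exp (-(1 / 4) * ξ ^ 2 + c * |ξ|) := by rw [Real.exp_add]; ring
    _ ≤ A * Real.exp (2 * c ^ 2 + -(1 / 8) * ξ ^ 2) := by
        refine mul_le_mul_of_nonneg_left (Real.exp_le_exp.2 ?_) hA
        nlinarith [sq_nonneg (|ξ| - 4 * c), sq_abs ξ]
    _ = _ := by rw [Real.exp_add]; ring

lemma integral_mul_deriv_testFunction {u u' φ : ℝ → ℂ} (hu : ∀ x, HasDerivAt u (u' x) x)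
    (hu' : Continuous u') (hφ : ContDiff ℝ 1 φ) (hφc : HasCompactSupport φ) :
    ∫ x : ℝ, u x * deriv φ x = -∫ x : ℝ, u' x * φ x := by
  have hcu : Continuous u := continuous_iff_continuousAt.2 fun x => (hu x).continuousAt
  have hφ' : Continuous (deriv φ) := hφ.continuous_deriv le_rfl
  refine integral_mul_deriv_eq_deriv_mul_of_integrable (fun x _ => hu x)
    (fun x _ => (hφ.differentiable one_ne_zero x).hasDerivAt) ?_ ?_ ?_
  · exact (hcu.mul hφ').integrable_of_hasCompactSupport hφc.deriv.mul_left
  · exact (hu'.mul hφ.continuous).integrable_of_hasCompactSupport hφc.mul_left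
  · exact (hcu.mul hφ.continuous).integrable_of_hasCompactSupport hφc.mul_left

lemma perturbedEigenEq_of_strong {θ f f₁ f₂ g : ℝ → ℂ} {ζ : ℂ}
    (hf : ∀ x, HasDerivAt f (f₁ x) x) (hf₁ : ∀ x, HasDerivAt f₁ (f₂ x) x) (hf₂ : Continuous f₂)
    (hg : ∀ x : ℝ, HasDerivAt (fun x : ℝ => x * f x) (g x) x) (hgc : Continuous g)
    (h : ∀ x, f₂ x + g x + conv θ f x = ζ * f x) : PerturbedEigenEq θ ζ f := by
  intro φ hφ hφc
  have hφ1 : ContDiff ℝ ∞ (deriv φ) := (contDiff_infty_iff_deriv.1 hφ).2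
  have hφ2 : ContDiff ℝ ∞ (deriv (deriv φ)) := (contDiff_infty_iff_deriv.1 hφ1).2
  have le1 : (1 : WithTop ℕ∞) ≤ ∞ := by exact_mod_cast le_top
  have hcf : Continuous f := continuous_iff_continuousAt.2 fun x => (hf x).continuousAt
  have hcf₁ : Continuous f₁ := continuous_iff_continuousAt.2 fun x => (hf₁ x).continuousAt
  have i1 := integral_mul_deriv_testFunction hf hcf₁ (hφ1.of_le le1) hφc.deriv
  have i2 := integral_mul_deriv_testFunction hf₁ hf₂ (hφ.of_le le1) hφc
  have i3 := integral_mul_deriv_testFunction hg hgc (hφ.of_le le1) hφc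
  have hint : ∀ {u ψ : ℝ → ℂ}, Continuous u → Continuous ψ → HasCompactSupport ψ →
      Integrable fun x => u x * ψ x := fun hu hψ hψc =>
    (hu.mul hψ).integrable_of_hasCompactSupport hψc.mul_left
  have s1 : ∫ x : ℝ, f x * (deriv (deriv φ) x - x * deriv φ x) =
      (∫ x : ℝ, f x * deriv (deriv φ) x) - ∫ x : ℝ, x * f x * deriv φ x := by
    rw [← integral_sub (hint hcf hφ2.continuous hφc.deriv.deriv)
      (hint (by fun_prop) hφ1.continuous hφc.deriv)]
    congr 1 with x
    ring
  have j : Integrable fun x => ζ * (f x * φ x) - f₂ x * φ x :=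
    ((hint hcf hφ.continuous hφc).const_mul _).sub (hint hf₂ hφ.continuous hφc)
  have s2 : ∫ x : ℝ, conv θ f x * φ x =
      ζ * (∫ x : ℝ, f x * φ x) - (∫ x : ℝ, f₂ x * φ x) - ∫ x : ℝ, g x * φ x := by
    rw [← integral_const_mul, ← integral_sub ((hint hcf hφ.continuous hφc).const_mul _)
      (hint hf₂ hφ.continuous hφc), ← integral_sub
      j (hint hgc hφ.continuous hφc)]
    congr 1 with x
    linear_combination φ x * h x
  rw [s1, s2, i1, i2, i3]
  ring

lemma exists_eigenfunction {β : ℝ} (hβ : 0 < β) {θ : ℝ → ℂ}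
    (hθmeas : AEStronglyMeasurable θ volume)
    (hθint : Integrable fun x : ℝ => ‖θ x‖ * Real.exp (β / 2 * |x|))
    (hθmass : ∫ x : ℝ, θ x = 0) (k : ℕ) :
    ∃ f : ℝ → ℂ, memE β f ∧ ¬ f =ᵐ[volume] 0 ∧ PerturbedEigenEq θ (-(k : ℂ)) f := by
  have ha : 0 < β / 2 := by positivity
  have hθ : Integrable θ := by
    refine hθint.mono hθmeas ?_
    filter_upwards with x
    rw [norm_mul, norm_norm, Real.norm_of_nonneg (Real.exp_pos _).le]
    exact le_mul_of_one_le_right (norm_nonneg _) (Real.one_le_exp (by positivity))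
  obtain ⟨F, A, hA, hd, hode, hF, hF', hF1⟩ := exists_solution_on_strip ha
    (q := fourierC θ)
    (differentiableOn_fourierC_strip hθmeas fun b hb => integrable_weight_mono hθmeas hθint hb.le)
    (by rw [fourierC_zero, hθmass]) (fun z hz => norm_fourierC_le hθint (le_of_lt hz)) k
  have hre : ∀ ξ : ℝ, (ξ : ℂ) ∈ strip (β / 2) := ofReal_mem_strip ha
  have hFc : Continuous fun ξ : ℝ => F ξ :=
    hd.continuousOn.comp_continuous continuous_ofReal hre
  have hF'c : Continuous fun ξ : ℝ => deriv F ξ :=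
    (hd.deriv (isOpen_strip _)).continuousOn.comp_continuous continuous_ofReal hre
  have hFd : ∀ ξ : ℝ, HasDerivAt (fun ξ : ℝ => F ξ) (deriv F ξ) ξ := fun ξ =>
    (hd.differentiableAt ((isOpen_strip _).mem_nhds (hre ξ))).hasDerivAt.comp_ofReal
  have m0 := hFc.aestronglyMeasurable (μ := volume)
  have m0' := hF'c.aestronglyMeasurable (μ := volume)
  have m1 : AEStronglyMeasurable (fun ξ : ℝ => I * ξ * F ξ) volume :=
    (Continuous.mul (by fun_prop) hFc).aestronglyMeasurable
  have m2 : AEStronglyMeasurable (fun ξ : ℝ => I * ξ * (I * ξ * F ξ)) volume :=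
    (Continuous.mul (by fun_prop) (Continuous.mul (by fun_prop) hFc)).aestronglyMeasurable
  have m3 : AEStronglyMeasurable (fun ξ : ℝ => I * ξ * deriv F ξ) volume :=
    (Continuous.mul (by fun_prop) hF'c).aestronglyMeasurable
  have w0 := integrable_gaussian_weight m0 fun ξ => by simpa using hF _ (hre ξ)
  have w0' := integrable_gaussian_weight m0' fun ξ => by simpa using hF' _ (hre ξ)
  have w1 := integrable_I_mul_weight m0 w0
  have w2 := integrable_I_mul_weight m1 w1
  have w3 := integrable_I_mul_weight m0' w0'
  have hFi : Integrable fun ξ : ℝ => F ξ := by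
    simpa using integrable_mul_cexp_neg m0 w0 0
  set f : ℝ → ℂ := invF fun ξ => F ξ with hf
  have hfc : Continuous f := continuous_invF m0 w0
  refine ⟨f, ?_, ?_, ?_⟩
  · refine memE_of_decay (C := (2 * Real.pi)⁻¹ *
      (2 * (A * ∫ ξ : ℝ, Real.exp (-(1 / 4) * ξ ^ 2)))) hβ hfc fun x => ?_
    have h := norm_fourierC_decay ha hd hA hF hF' x
    have hn : ‖f x‖ = (2 * Real.pi)⁻¹ * ‖fourierC (fun ξ : ℝ => F ξ) (-x)‖ := by
      rw [hf, invF, norm_mul]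
      congr 1
      rw [norm_real, Real.norm_of_nonneg (by positivity)]
    rw [hn]
    have := mul_le_mul_of_nonneg_left h (show 0 ≤ (2 * Real.pi)⁻¹ by positivity)
    linarith
  · intro h0
    have h1 : f = 0 := hfc.ae_eq_iff_eq volume continuous_zero |>.1 h0
    have h2 : ∀ ξ : ℝ, fourierC (fun ξ : ℝ => F ξ) ξ = 0 := by
      intro ξ
      have := congrFun h1 (-ξ)
      simpa [hf, invF, Real.pi_ne_zero] using this
    have h3 := ae_eq_zero_of_fourierC_eq_zero hFi h2
    have h4 := (hFc.ae_eq_iff_eq volume continuous_zero).1 h3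
    exact hF1 (by simpa using congrFun h4 1)
  · have hxf : ∀ x : ℝ, x * f x = I * invF (fun ξ => deriv F ξ) x :=
      mul_invF_eq m0 m0' w0 w0' hFd
    refine perturbedEigenEq_of_strong (f₁ := invF fun ξ => I * ξ * F ξ)
      (f₂ := invF fun ξ => I * ξ * (I * ξ * F ξ))
      (g := fun x => I * invF (fun ξ => I * ξ * deriv F ξ) x)
      (hasDerivAt_invF m0 w0) (hasDerivAt_invF m1 w1) (continuous_invF m2 w2) ?_
      (continuous_const.mul (continuous_invF m3 w3)) ?_
    · intro x
      rw [funext hxf]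
      exact (hasDerivAt_invF m0' w0' x).const_mul I
    · intro x
      rw [conv_invF hθ hFi, hf, invF, invF, invF, invF]
      have j0 := integrable_mul_cexp_neg m0 w0 x
      have j2 := integrable_mul_cexp_neg m2 w2 x
      have j3 := integrable_mul_cexp_neg m3 w3 x
      have hsum : fourierC (fun ξ => fourierC θ ξ * F ξ) (-x) =
          -k * fourierC (fun ξ : ℝ => F ξ) (-x)
          - fourierC (fun ξ : ℝ => I * ξ * (I * ξ * F ξ)) (-x)
          - I * fourierC (fun ξ : ℝ => I * ξ * deriv F ξ) (-x) := by
        have j02 : Integrable fun ξ : ℝ => -k * (F ξ * Complex.exp (-I * (-x) * ξ)) -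
            I * ξ * (I * ξ * F ξ) * Complex.exp (-I * (-x) * ξ) := (j0.const_mul _).sub j2
        simp only [fourierC.eq_1 _ (-(x : ℂ))]
        rw [← integral_const_mul, ← integral_const_mul, ← integral_sub (j0.const_mul _) j2,
          ← integral_sub j02 (j3.const_mul _)]
        congr 1 with ξ
        linear_combination (-Complex.exp (-I * (-x) * ξ)) * hode ξ (hre ξ)
          + (ξ * (ξ * F ξ + deriv F ξ) * Complex.exp (-I * (-x) * ξ)) * I_sq
      rw [hsum]
      ring

/-- under the conditions on `θ`, the perturbed eigenvalue equation
`𝔏f + θ*f = ζf` has a nonzero solution `f ∈ ℰ` iff `ζ = −k`, `k ∈ ℕ₀`; moreover any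
two solutions in `ℰ` are linearly dependent (the eigenspaces are one-dimensional). -/
theorem perturbed_eigenvalues (β : ℝ) (hβ : 0 < β) (θ θ' : ℝ → ℂ)
    (hθmeas : AEStronglyMeasurable θ volume)
    (hθ'meas : AEStronglyMeasurable θ' volume)
    (hderiv : IsDistribDeriv θ θ')
    (hθint : Integrable (fun x : ℝ => ‖θ x‖ * Real.exp (β * |x| / 2)))
    (hθ'int : Integrable (fun x : ℝ => ‖θ' x‖ * Real.exp (β * |x| / 2)))
    (hθmass : ∫ x : ℝ, θ x = 0) (ζ : ℂ) :
    ((∃ f : ℝ → ℂ, memE β f ∧ ¬ f =ᵐ[volume] 0 ∧ PerturbedEigenEq θ ζ f)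
        ↔ ∃ k : ℕ, ζ = -(k : ℂ)) ∧
    (∀ f₁ f₂ : ℝ → ℂ, memE β f₁ → memE β f₂ →
      PerturbedEigenEq θ ζ f₁ → PerturbedEigenEq θ ζ f₂ →
      ∃ c₁ c₂ : ℂ, (c₁, c₂) ≠ (0, 0) ∧
        (fun x => c₁ * f₁ x + c₂ * f₂ x) =ᵐ[volume] 0) := by
  have hθint' : Integrable fun x : ℝ => ‖θ x‖ * Real.exp (β / 2 * |x|) := by
    simpa only [mul_div_right_comm] using hθint
  refine ⟨⟨?_, ?_⟩, fun f₁ f₂ h₁ h₂ e₁ e₂ =>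
    exists_linear_relation_of_solutions hβ hθmeas hθint' hθmass h₁ h₂ e₁ e₂⟩
  · rintro ⟨f, hf, hne, h⟩
    exact exists_nat_of_solution hβ hθmeas hθint' hθmass hf hne h
  · rintro ⟨k, rfl⟩
    exact exists_eigenfunction hβ hθmeas hθint' hθmass k
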